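/- The position and momentum operators of the quantum mechanical q-phase space, realized on the quantum-plane monomial module V, satisfy the deformed Heisenberg relations [P_x, X̂] = iℏ·Q, [P_y, Ŷ] = iℏ·Q, [P_x, Ŷ] = 0, and [P_y, X̂] = 0, where Q is the diagonal operator Q e(n,m) = q^{2(m−n)} e(n,m) (i.e. Q = exp((2Λ/ℏ)·L)). -/

import Mathlib

noncomputable section

/-- The quantum-plane monomial module: finitely supported functions `ℕ × ℕ → ℂ`,
with basis vector `e(n,m)` thought of as the monomial `z₊ⁿ z₋ᵐ`. -/
abbrev V : Type := (ℕ × ℕ) →₀ ℂ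

/-- The `p`-integer `[k]_p = (1 − pᵏ)/(1 − p)`. -/
def qint (p : ℂ) (k : ℕ) : ℂ := (1 - p ^ k) / (1 - p)

/-- Right multiplication by `z₊`: `Ẑ₊ e(n,m) = q^{2m} e(n+1,m)`. -/
def Zp (q : ℝ) : V →ₗ[ℂ] V :=
  Finsupp.lsum ℂ fun nm => ((q : ℂ) ^ (2 * nm.2)) • Finsupp.lsingle (nm.1 + 1, nm.2)

/-- Right multiplication by `z₋`: `Ẑ₋ e(n,m) = e(n,m+1)`. -/
def Zm : V →ₗ[ℂ] V :=
  Finsupp.lsum ℂ fun nm => Finsupp.lsingle (nm.1, nm.2 + 1)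

/-- `P₊ e(n,m) = iℏ [n]_{q⁻²} e(n−1,m)` (the `n = 0` term vanishes since `[0] = 0`). -/
def Pp (q ℏ : ℝ) : V →ₗ[ℂ] V :=
  Finsupp.lsum ℂ fun nm =>
    (Complex.I * (ℏ : ℂ) * qint (((q : ℂ) ^ 2)⁻¹) nm.1) • Finsupp.lsingle (nm.1 - 1, nm.2)

/-- `P₋ e(n,m) = iℏ q^{−2n} [m]_{q²} e(n,m−1)` (the `m = 0` term vanishes since `[0] = 0`). -/
def Pm (q ℏ : ℝ) : V →ₗ[ℂ] V :=
  Finsupp.lsum ℂ fun nm =>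
    (Complex.I * (ℏ : ℂ) * ((q : ℂ) ^ (2 * nm.1))⁻¹ * qint ((q : ℂ) ^ 2) nm.2) •
      Finsupp.lsingle (nm.1, nm.2 - 1)

/-- The angular momentum operator `L e(n,m) = ℏ (n − m) e(n,m)`. -/
def Lop (ℏ : ℝ) : V →ₗ[ℂ] V :=
  Finsupp.lsum ℂ fun nm => ((ℏ : ℂ) * ((nm.1 : ℂ) - (nm.2 : ℂ))) • Finsupp.lsingle nm

/-- The diagonal operator `Q e(n,m) = q^{2(m−n)} e(n,m)`, i.e. `Q = exp((2Λ/ℏ)·L)`. -/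
def Qop (q : ℝ) : V →ₗ[ℂ] V :=
  Finsupp.lsum ℂ fun nm =>
    ((q : ℂ) ^ (2 * nm.2) * ((q : ℂ) ^ (2 * nm.1))⁻¹) • Finsupp.lsingle nm

/-- `X̂ = (Ẑ₊ + Ẑ₋)/√2`. -/
def Xop (q : ℝ) : V →ₗ[ℂ] V := ((Real.sqrt 2 : ℂ))⁻¹ • (Zp q + Zm)

/-- `Ŷ = (Ẑ₊ − Ẑ₋)/(√2 i)`. -/
def Yop (q : ℝ) : V →ₗ[ℂ] V := (((Real.sqrt 2 : ℂ)) * Complex.I)⁻¹ • (Zp q - Zm)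

/-- `P_x = (P₊ + P₋)/√2`. -/
def Px (q ℏ : ℝ) : V →ₗ[ℂ] V := ((Real.sqrt 2 : ℂ))⁻¹ • (Pp q ℏ + Pm q ℏ)

/-- `P_y = i (P₊ − P₋)/√2`. -/
def Py (q ℏ : ℝ) : V →ₗ[ℂ] V := (Complex.I / (Real.sqrt 2 : ℂ)) • (Pp q ℏ - Pm q ℏ)


theorem qint_zero (p : ℂ) : qint p 0 = 0 := by simp [qint]

theorem qint_succ {p : ℂ} (hp : p ≠ 1) (k : ℕ) : qint p (k + 1) = qint p k + p ^ k := by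
  have h : 1 - p ≠ 0 := sub_ne_zero.mpr hp.symm
  unfold qint
  field_simp
  ring

section Basis

variable (q ℏ : ℝ) (n m : ℕ) (c : ℂ)

theorem Zp_single : Zp q (Finsupp.single (n, m) c) =
    Finsupp.single (n + 1, m) ((q : ℂ) ^ (2 * m) * c) := by
  simp [Zp]

theorem Zm_single : Zm (Finsupp.single (n, m) c) = Finsupp.single (n, m + 1) c := by
  simp [Zm]

theorem Pp_single : Pp q ℏ (Finsupp.single (n, m) c) =
    Finsupp.single (n - 1, m) (Complex.I * (ℏ : ℂ) * qint (((q : ℂ) ^ 2)⁻¹) n * c) := by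
  simp [Pp]

theorem Pm_single : Pm q ℏ (Finsupp.single (n, m) c) =
    Finsupp.single (n, m - 1)
      (Complex.I * (ℏ : ℂ) * ((q : ℂ) ^ (2 * n))⁻¹ * qint ((q : ℂ) ^ 2) m * c) := by
  simp [Pm]

theorem Qop_single : Qop q (Finsupp.single (n, m) c) =
    Finsupp.single (n, m) ((q : ℂ) ^ (2 * m) * ((q : ℂ) ^ (2 * n))⁻¹ * c) := by
  simp [Qop]

end Basis

section Commutation

variable {q : ℝ} (ℏ : ℝ)

theorem Pp_comp_Zp (hq : (q : ℂ) ^ 2 ≠ 1) :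
    Pp q ℏ ∘ₗ Zp q = Zp q ∘ₗ Pp q ℏ + (Complex.I * (ℏ : ℂ)) • Qop q := by
  refine Finsupp.lhom_ext ?_
  rintro ⟨n, m⟩ c
  simp only [LinearMap.add_apply, LinearMap.smul_apply, LinearMap.comp_apply, Zp_single, Pp_single,
    Qop_single, Finsupp.smul_single, smul_eq_mul, Nat.add_sub_cancel]
  rw [qint_succ (inv_ne_one.mpr hq)]
  rcases n with _ | n
  · simp only [qint_zero, mul_zero, zero_mul, Finsupp.single_zero, zero_add]
    congr 1
    simp
  · rw [Nat.add_sub_cancel, ← Finsupp.single_add, inv_pow, ← pow_mul]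
    congr 1
    ring

theorem Pp_comp_Zm : Pp q ℏ ∘ₗ Zm = Zm ∘ₗ Pp q ℏ := by
  refine Finsupp.lhom_ext ?_
  rintro ⟨n, m⟩ c
  simp only [LinearMap.comp_apply, Zm_single, Pp_single]

theorem Pm_comp_Zp (hq : (q : ℂ) ≠ 0) : Pm q ℏ ∘ₗ Zp q = Zp q ∘ₗ Pm q ℏ := by
  refine Finsupp.lhom_ext ?_
  rintro ⟨n, m⟩ c
  simp only [LinearMap.comp_apply, Zp_single, Pm_single]
  rcases m with _ | m
  · simp [qint_zero]
  · rw [Nat.add_sub_cancel]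
    congr 1
    field_simp
    ring

theorem Pm_comp_Zm (hq : (q : ℂ) ^ 2 ≠ 1) :
    Pm q ℏ ∘ₗ Zm = Zm ∘ₗ Pm q ℏ + (Complex.I * (ℏ : ℂ)) • Qop q := by
  refine Finsupp.lhom_ext ?_
  rintro ⟨n, m⟩ c
  simp only [LinearMap.add_apply, LinearMap.smul_apply, LinearMap.comp_apply, Zm_single, Pm_single,
    Qop_single, Finsupp.smul_single, smul_eq_mul, Nat.add_sub_cancel]
  rw [qint_succ hq, ← pow_mul]
  rcases m with _ | m
  · simp only [qint_zero, mul_zero, zero_mul, Finsupp.single_zero, zero_add]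
    congr 1
    simp
    ring
  · rw [Nat.add_sub_cancel, ← Finsupp.single_add]
    congr 1
    ring

end Commutation

/-- The position and momentum operators of the quantum mechanical q-phase space
satisfy the deformed Heisenberg relations `[P_x, X̂] = iℏ Q`, `[P_y, Ŷ] = iℏ Q`,
`[P_x, Ŷ] = 0`, `[P_y, X̂] = 0`. -/
theorem deformed_heisenberg_relations (q ℏ : ℝ) (hq0 : 0 < q) (hq1 : q < 1) (hℏ : 0 < ℏ) :
    Px q ℏ ∘ₗ Xop q - Xop q ∘ₗ Px q ℏ = (Complex.I * (ℏ : ℂ)) • Qop q ∧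
    Py q ℏ ∘ₗ Yop q - Yop q ∘ₗ Py q ℏ = (Complex.I * (ℏ : ℂ)) • Qop q ∧
    Px q ℏ ∘ₗ Yop q - Yop q ∘ₗ Px q ℏ = 0 ∧
    Py q ℏ ∘ₗ Xop q - Xop q ∘ₗ Py q ℏ = 0 := by
  have hq : (q : ℂ) ≠ 0 := by exact_mod_cast hq0.ne'
  have hq2 : (q : ℂ) ^ 2 ≠ 1 := by exact_mod_cast (pow_lt_one₀ hq0.le hq1 two_ne_zero).ne
  have hs : ((Real.sqrt 2 : ℝ) : ℂ) ^ 2 = 2 := by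
    exact_mod_cast Real.sq_sqrt (zero_le_two (α := ℝ))
  have hs0 : ((Real.sqrt 2 : ℝ) : ℂ) ≠ 0 := by
    intro h
    simp [h] at hs
  have hx : ((Real.sqrt 2 : ℝ) : ℂ)⁻¹ * ((Real.sqrt 2 : ℝ) : ℂ)⁻¹ = 1 / 2 := by
    rw [← mul_inv, ← sq, hs, one_div]
  have hy : Complex.I / ((Real.sqrt 2 : ℝ) : ℂ) * (((Real.sqrt 2 : ℝ) : ℂ) * Complex.I)⁻¹ =
      1 / 2 := by
    rw [← hx]
    field_simp [Complex.I_ne_zero]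
  simp only [Px, Py, Xop, Yop, LinearMap.smul_comp, LinearMap.comp_smul, LinearMap.add_comp,
    LinearMap.comp_add, LinearMap.sub_comp, LinearMap.comp_sub, Pp_comp_Zp ℏ hq2, Pp_comp_Zm,
    Pm_comp_Zp ℏ hq, Pm_comp_Zm ℏ hq2]
  refine ⟨?_, ?_, by module, by module⟩
  · trans (2 * (((Real.sqrt 2 : ℝ) : ℂ)⁻¹ * ((Real.sqrt 2 : ℝ) : ℂ)⁻¹)) • (Complex.I * (ℏ : ℂ)) • Qop q
    · module
    · rw [hx]
      module
  · trans (2 * (Complex.I / ((Real.sqrt 2 : ℝ) : ℂ) * (((Real.sqrt 2 : ℝ) : ℂ) * Complex.I)⁻¹)) • (Complex.I * (ℏ : ℂ)) • Qop q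
    · module
    · rw [hy]
      module

end
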